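/- Discrete Taylor–Lagrange formula: Let n ≥ 1 and f : ℕ_0^n → ℝ. Assume there exist a real number M ≥ 0 and integers K, p ≥ 0 such that for every multi-index m ∈ ℕ_0^n with |m| = K+1 and every α ∈ ℕ_0^n, |δ^m f(α)| ≤ M ⟨α⟩^p. Then there exists a real polynomial F in n variables of total degree at most K such that for all α ∈ ℕ_0^n, |f(α) − F(α)| ≤ M n^{K+1} ⟨α⟩^{p+K+1}. -/

import Mathlib

/-- `⟨x⟩ = √(1 + x²)`. -/
noncomputable def jap (x : ℝ) : ℝ := Real.sqrt (1 + x ^ 2)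

/-- Discrete derivative in the `i`-th variable of a function on multi-indices:
`δᵢv(α) = v(α) − v(α + eᵢ)`. -/
noncomputable def dDeriv {n : ℕ} (i : Fin n) (v : (Fin n → ℕ) → ℝ) : (Fin n → ℕ) → ℝ :=
  fun α => v α - v (Function.update α i (α i + 1))

/-- Iterated discrete derivative `δ^m = δ₁^{m₁} ⋯ δₙ^{mₙ}`. -/
noncomputable def dDerivM {n : ℕ} (m : Fin n → ℕ) (v : (Fin n → ℕ) → ℝ) : (Fin n → ℕ) → ℝ :=
  ((List.finRange n).map (fun i => (dDeriv i)^[m i])).foldr (· ∘ ·) id v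

/-- The discrete derivative as a linear endomorphism. -/
noncomputable def dDerivLin {n : ℕ} (i : Fin n) : Module.End ℝ ((Fin n → ℕ) → ℝ) where
  toFun := dDeriv i
  map_add' u v := by ext α; simp only [dDeriv, Pi.add_apply]; ring
  map_smul' c v := by
    ext α; simp only [dDeriv, Pi.smul_apply, smul_eq_mul, RingHom.id_apply]; ring

/-- The iterated discrete derivative as a linear endomorphism. -/
noncomputable def dDerivMLin {n : ℕ} (m : Fin n → ℕ) : Module.End ℝ ((Fin n → ℕ) → ℝ) :=
  ((List.finRange n).map (fun i => dDerivLin i ^ m i)).prod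

theorem dDerivLin_pow_apply {n : ℕ} (i : Fin n) (k : ℕ) (v : (Fin n → ℕ) → ℝ) :
    (dDerivLin i ^ k) v = (dDeriv i)^[k] v := by
  rw [Module.End.pow_apply]; rfl

theorem dDerivMLin_apply {n : ℕ} (m : Fin n → ℕ) (v : (Fin n → ℕ) → ℝ) :
    dDerivMLin m v = dDerivM m v := by
  unfold dDerivMLin dDerivM
  induction List.finRange n with
  | nil => rfl
  | cons a l ih =>
    simp only [List.map_cons, List.prod_cons, List.foldr_cons, Function.comp_apply,
      Module.End.mul_apply]
    rw [ih, dDerivLin_pow_apply]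

theorem dDerivLin_commute {n : ℕ} (i j : Fin n) : Commute (dDerivLin i) (dDerivLin j) := by
  ext v α
  rcases eq_or_ne i j with rfl | h
  · rfl
  · change (v α - v _) - (v _ - v _) = (v α - v _) - (v _ - v _)
    rw [Function.update_of_ne h.symm, Function.update_of_ne h, Function.update_comm h]
    ring

theorem mul_prod_map_pow_of_commute {ι R : Type*} [DecidableEq ι] [Monoid R] (A : ι → R)
    (hA : ∀ i j, Commute (A i) (A j)) (m : ι → ℕ) (i : ι) (l : List ι) (hl : l.Nodup)
    (hi : i ∈ l) :
    A i * (l.map fun j => A j ^ m j).prod =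
      (l.map fun j => A j ^ Function.update m i (m i + 1) j).prod := by
  induction l with
  | nil => simp at hi
  | cons a l ih =>
    rw [List.nodup_cons] at hl
    simp only [List.map_cons, List.prod_cons]
    rcases eq_or_ne i a with rfl | h
    · rw [← mul_assoc, ← pow_succ', Function.update_self]
      congr 2
      refine List.map_congr_left fun j hj => ?_
      rw [Function.update_of_ne]
      rintro rfl
      exact hl.1 hj
    · rw [← ih hl.2 ((List.mem_cons.1 hi).resolve_left h), Function.update_of_ne h.symm,
        ← mul_assoc, ← mul_assoc, ((hA i a).pow_right (m a)).eq]

theorem dDerivLin_dDerivMLin {n : ℕ} (i : Fin n) (m : Fin n → ℕ) (v : (Fin n → ℕ) → ℝ) :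
    dDerivLin i (dDerivMLin m v) = dDerivMLin (Function.update m i (m i + 1)) v := by
  rw [← Module.End.mul_apply, dDerivMLin, mul_prod_map_pow_of_commute _ dDerivLin_commute _ _ _
    (List.nodup_finRange n) (List.mem_finRange i), dDerivMLin]

theorem dDerivMLin_zero {n : ℕ} (v : (Fin n → ℕ) → ℝ) : dDerivMLin 0 v = v := by
  simp [dDerivMLin]

/-- The difference operator on sequences. -/
def seqDiff (φ : ℕ → ℝ) : ℕ → ℝ := fun a => φ a - φ (a + 1)

theorem dDerivLin_prod {n : ℕ} (i : Fin n) (φ : Fin n → ℕ → ℝ) :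
    dDerivLin i (fun α => ∏ j, φ j (α j)) =
      fun α => ∏ j, Function.update φ i (seqDiff (φ i)) j (α j) := by
  ext α
  change ∏ j, φ j (α j) - ∏ j, φ j (Function.update α i (α i + 1) j) = _
  rw [Fintype.prod_eq_mul_prod_compl i, Fintype.prod_eq_mul_prod_compl i,
    Fintype.prod_eq_mul_prod_compl i (fun j => Function.update φ i (seqDiff (φ i)) j (α j))]
  have h1 : ∏ j ∈ {i}ᶜ, φ j (Function.update α i (α i + 1) j) = ∏ j ∈ {i}ᶜ, φ j (α j) :=
    Finset.prod_congr rfl fun j hj => by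
      rw [Function.update_of_ne (by simpa using hj)]
  have h2 : ∏ j ∈ {i}ᶜ, Function.update φ i (seqDiff (φ i)) j (α j) = ∏ j ∈ {i}ᶜ, φ j (α j) :=
    Finset.prod_congr rfl fun j hj => by
      rw [Function.update_of_ne (by simpa using hj)]
  rw [h1, h2, Function.update_self, Function.update_self, seqDiff]
  ring

theorem dDerivLin_pow_prod {n : ℕ} (i : Fin n) (k : ℕ) (φ : Fin n → ℕ → ℝ) :
    (dDerivLin i ^ k) (fun α => ∏ j, φ j (α j)) =
      fun α => ∏ j, Function.update φ i (seqDiff^[k] (φ i)) j (α j) := by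
  induction k with
  | zero => simp
  | succ k ih =>
    rw [pow_succ', Module.End.mul_apply, ih, dDerivLin_prod, Function.update_self,
      Function.update_idem, Function.iterate_succ_apply']

theorem dDerivMLin_prod {n : ℕ} (m : Fin n → ℕ) (φ : Fin n → ℕ → ℝ) :
    dDerivMLin m (fun α => ∏ j, φ j (α j)) = fun α => ∏ j, (seqDiff^[m j] (φ j)) (α j) := by
  have key (l : List (Fin n)) (hl : l.Nodup) :
      (l.map fun i => dDerivLin i ^ m i).prod (fun α => ∏ j, φ j (α j)) =
        fun α => ∏ j, (if j ∈ l then seqDiff^[m j] (φ j) else φ j) (α j) := by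
    induction l with
    | nil => simp
    | cons a l ih =>
      rw [List.nodup_cons] at hl
      rw [List.map_cons, List.prod_cons, Module.End.mul_apply, ih hl.2,
        dDerivLin_pow_prod a (m a) (fun j => if j ∈ l then seqDiff^[m j] (φ j) else φ j)]
      ext α
      refine Finset.prod_congr rfl fun j _ => ?_
      rcases eq_or_ne j a with rfl | h
      · simp [hl.1]
      · simp [h]
  rw [dDerivMLin, key _ (List.nodup_finRange n)]
  simp

theorem seqDiff_iterate_choose (k m : ℕ) :
    seqDiff^[k] (fun a => (a.choose m : ℝ)) =
      fun a => if k ≤ m then (-1) ^ k * (a.choose (m - k) : ℝ) else 0 := by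
  induction k with
  | zero => simp
  | succ k ih =>
    rw [Function.iterate_succ_apply', ih]
    ext a
    simp only [seqDiff]
    rcases lt_trichotomy k m with h | rfl | h
    · obtain ⟨d, rfl⟩ := Nat.exists_eq_add_of_lt h
      rw [if_pos (by omega), if_pos (by omega), if_pos (by omega),
        show k + d + 1 - k = d + 1 by omega, show k + d + 1 - (k + 1) = d by omega,
        Nat.choose_succ_succ]
      push_cast
      ring
    · simp
    · rw [if_neg (by omega), if_neg (by omega), if_neg (by omega), sub_zero]

/-- The Newton basis polynomial `∏ᵢ (Xᵢ choose mᵢ)`. -/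
noncomputable def newtonPoly {n : ℕ} (m : Fin n → ℕ) : MvPolynomial (Fin n) ℝ :=
  ∏ i, Polynomial.aeval (MvPolynomial.X i)
    (Polynomial.C ((m i).factorial : ℝ)⁻¹ * descPochhammer ℝ (m i))

theorem eval_newtonPoly {n : ℕ} (m α : Fin n → ℕ) :
    MvPolynomial.eval (fun i => (α i : ℝ)) (newtonPoly m) =
      ∏ i, ((α i).choose (m i) : ℝ) := by
  rw [newtonPoly, map_prod]
  refine Finset.prod_congr rfl fun i _ => ?_
  have h (q : Polynomial ℝ) : MvPolynomial.eval (fun i => (α i : ℝ))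
      (Polynomial.aeval (MvPolynomial.X i) q) = q.eval (α i : ℝ) := by
    induction q using Polynomial.induction_on' with
    | add p q hp hq => simp [hp, hq]
    | monomial k a => simp [Polynomial.aeval_monomial, MvPolynomial.algebraMap_eq]
  rw [h, Polynomial.eval_mul, Polynomial.eval_C, descPochhammer_eval_eq_descFactorial,
    Nat.descFactorial_eq_factorial_mul_choose, Nat.cast_mul,
    inv_mul_cancel_left₀ (by exact_mod_cast Nat.factorial_ne_zero _)]

theorem totalDegree_aeval_X_le {σ R : Type*} [CommRing R] [Nontrivial R] (i : σ)
    (q : Polynomial R) :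
    (Polynomial.aeval (MvPolynomial.X i : MvPolynomial σ R) q).totalDegree ≤ q.natDegree := by
  rw [Polynomial.aeval_eq_sum_range]
  refine MvPolynomial.totalDegree_finsetSum_le fun k hk => ?_
  refine (MvPolynomial.totalDegree_smul_le _ _).trans
    ((MvPolynomial.totalDegree_X_pow i k).le.trans ?_)
  have := Finset.mem_range.1 hk
  omega

theorem totalDegree_newtonPoly_le {n : ℕ} (m : Fin n → ℕ) :
    (newtonPoly m).totalDegree ≤ ∑ i, m i := by
  refine (MvPolynomial.totalDegree_finsetProd _ _).trans (Finset.sum_le_sum fun i _ => ?_)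
  refine (totalDegree_aeval_X_le _ _).trans ((Polynomial.natDegree_C_mul_le _ _).trans ?_)
  rw [descPochhammer_natDegree]

theorem dDerivMLin_eval_newtonPoly {n : ℕ} (k m : Fin n → ℕ) :
    dDerivMLin k (fun α => MvPolynomial.eval (fun i => (α i : ℝ)) (newtonPoly m)) =
      fun α => ∏ i, if k i ≤ m i then (-1) ^ k i * ((α i).choose (m i - k i) : ℝ) else 0 := by
  simp only [eval_newtonPoly]
  rw [dDerivMLin_prod k (fun i a => (a.choose (m i) : ℝ))]
  simp only [seqDiff_iterate_choose]

theorem dDerivMLin_eval_newtonPoly_of_sum_lt {n : ℕ} (k m : Fin n → ℕ)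
    (h : ∑ i, m i < ∑ i, k i) :
    dDerivMLin k (fun α => MvPolynomial.eval (fun i => (α i : ℝ)) (newtonPoly m)) = 0 := by
  obtain ⟨i, -, hi⟩ := Finset.exists_lt_of_sum_lt h
  rw [dDerivMLin_eval_newtonPoly]
  ext α
  exact Finset.prod_eq_zero (Finset.mem_univ i) (if_neg (by omega))

theorem dDerivMLin_eval_newtonPoly_apply_zero {n : ℕ} (k m : Fin n → ℕ) :
    dDerivMLin k (fun α => MvPolynomial.eval (fun i => (α i : ℝ)) (newtonPoly m)) 0 =
      if k = m then (-1) ^ ∑ i, m i else 0 := by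
  rw [dDerivMLin_eval_newtonPoly]
  split_ifs with h
  · subst h
    simp [Finset.prod_pow_eq_pow_sum]
  · obtain ⟨i, hi⟩ := Function.ne_iff.1 h
    refine Finset.prod_eq_zero (Finset.mem_univ i) ?_
    split_ifs with hle
    · rw [Pi.zero_apply, Nat.choose_eq_zero_of_lt (by omega), Nat.cast_zero, mul_zero]
    · rfl

/-- Every function agrees to order `K` at the origin, in the sense of discrete derivatives, with
a polynomial of degree at most `K`. -/
theorem exists_discrete_taylor_polynomial {n : ℕ} (f : (Fin n → ℕ) → ℝ) (K : ℕ) :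
    ∃ F : MvPolynomial (Fin n) ℝ, F.totalDegree ≤ K ∧
      (∀ k : Fin n → ℕ, ∑ i, k i ≤ K →
        dDerivMLin k (fun α => MvPolynomial.eval (fun i => (α i : ℝ)) F) 0 =
          dDerivMLin k f 0) ∧
      ∀ k : Fin n → ℕ, K < ∑ i, k i →
        dDerivMLin k (fun α => MvPolynomial.eval (fun i => (α i : ℝ)) F) = 0 := by
  let S : Finset (Fin n → ℕ) :=
    (Fintype.piFinset fun _ => Finset.range (K + 1)).filter fun m => ∑ i, m i ≤ K
  have hS (m : Fin n → ℕ) : m ∈ S ↔ ∑ i, m i ≤ K := by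
    simp only [S, Finset.mem_filter, Fintype.mem_piFinset, Finset.mem_range,
      and_iff_right_iff_imp]
    intro h i
    have := Finset.single_le_sum (f := m) (fun _ _ => Nat.zero_le _) (Finset.mem_univ i)
    omega
  let c (m : Fin n → ℕ) : ℝ := (-1) ^ (∑ i, m i) * dDerivMLin m f 0
  have hF (k : Fin n → ℕ) :
      dDerivMLin k (fun α => MvPolynomial.eval (fun i => (α i : ℝ))
        (∑ m ∈ S, c m • newtonPoly m)) =
      ∑ m ∈ S, c m • dDerivMLin k
        (fun α => MvPolynomial.eval (fun i => (α i : ℝ)) (newtonPoly m)) := by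
    simp only [← map_smul, ← map_sum]
    congr 1
    ext α
    simp [Finset.sum_apply]
  refine ⟨∑ m ∈ S, c m • newtonPoly m, ?_, fun k hk => ?_, fun k hk => ?_⟩
  · exact MvPolynomial.totalDegree_finsetSum_le fun m hm =>
      (MvPolynomial.totalDegree_smul_le _ _).trans
        ((totalDegree_newtonPoly_le m).trans ((hS m).1 hm))
  · rw [hF]
    simp only [Finset.sum_apply, Pi.smul_apply, dDerivMLin_eval_newtonPoly_apply_zero,
      smul_eq_mul, mul_ite, mul_zero]
    rw [Finset.sum_ite_eq, if_pos ((hS k).2 hk), mul_right_comm, ← mul_pow]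
    simp
  · rw [hF]
    refine Finset.sum_eq_zero fun m hm => ?_
    rw [dDerivMLin_eval_newtonPoly_of_sum_lt k m (((hS m).1 hm).trans_lt hk), smul_zero]

theorem abs_le_of_abs_dDeriv_le {n : ℕ} (v : (Fin n → ℕ) → ℝ) (h0 : v 0 = 0) (B : ℕ → ℝ)
    (hB : Monotone B) (hv : ∀ i β, |dDeriv i v β| ≤ B (∑ j, β j)) (α : Fin n → ℕ) :
    |v α| ≤ (∑ j, α j : ℕ) * B (∑ j, α j) := by
  induction hs : ∑ j, α j generalizing α with
  | zero =>
    have : α = 0 := by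
      ext j
      exact (Finset.sum_eq_zero_iff.1 hs) j (Finset.mem_univ j)
    simp [this, h0]
  | succ s ih =>
    obtain ⟨i, -, hi⟩ := Finset.exists_ne_zero_of_sum_ne_zero (by omega : ∑ j, α j ≠ 0)
    set β := Function.update α i (α i - 1) with hβ
    have hαβ : Function.update β i (β i + 1) = α := by
      rw [hβ, Function.update_self, Function.update_idem, Nat.sub_add_cancel (by omega),
        Function.update_eq_self]
    have hsum : ∑ j, β j = s := by
      have h1 := Finset.sum_update_of_mem (Finset.mem_univ i) α (α i - 1)
      have h2 := Finset.sum_update_of_mem (Finset.mem_univ i) α (α i)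
      rw [Function.update_eq_self] at h2
      rw [← hβ] at h1
      omega
    have h1 := ih β hsum
    have h2 := hv i β
    rw [dDeriv, hαβ, hsum] at h2
    have h3 : |v α| ≤ |v β| + |v β - v α| := by
      have := abs_sub (v β) (v β - v α)
      rwa [sub_sub_cancel] at this
    calc |v α| ≤ s * B s + B s := by linarith
      _ = ((s + 1 : ℕ) : ℝ) * B s := by push_cast; ring
      _ ≤ ((s + 1 : ℕ) : ℝ) * B (s + 1) := by
        gcongr
        exact hB (Nat.le_succ s)

theorem jap_nonneg (x : ℝ) : 0 ≤ jap x := Real.sqrt_nonneg _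

theorem jap_mono {x y : ℝ} (hx : 0 ≤ x) (h : x ≤ y) : jap x ≤ jap y := by
  unfold jap
  gcongr

theorem le_jap (x : ℝ) : x ≤ jap x := Real.le_sqrt_of_sq_le (by linarith)

/-- A function whose discrete derivatives of order at most `K` vanish at the origin is controlled
by its derivatives of order `K + 1`. -/
theorem abs_dDerivMLin_le {n : ℕ} (g : (Fin n → ℕ) → ℝ) (M : ℝ) (hM : 0 ≤ M) (K p : ℕ)
    (h0 : ∀ k : Fin n → ℕ, ∑ i, k i ≤ K → dDerivMLin k g 0 = 0)
    (hd : ∀ m : Fin n → ℕ, ∑ i, m i = K + 1 → ∀ α : Fin n → ℕ,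
      |dDerivMLin m g α| ≤ M * jap (∑ i, α i : ℕ) ^ p)
    (j : ℕ) (m : Fin n → ℕ) (hm : ∑ i, m i + j = K + 1) (α : Fin n → ℕ) :
    |dDerivMLin m g α| ≤ M * jap (∑ i, α i : ℕ) ^ p * (∑ i, α i : ℕ) ^ j := by
  induction j generalizing m α with
  | zero => simpa using hd m hm α
  | succ j ih =>
    have hB : Monotone fun s : ℕ => M * jap s ^ p * (s : ℝ) ^ j := by
      intro s t hst
      have hc : (s : ℝ) ≤ t := by exact_mod_cast hst
      have h1 := jap_mono (Nat.cast_nonneg s) hc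
      have h2 := jap_nonneg s
      have h3 := jap_nonneg t
      dsimp only
      gcongr
    refine (abs_le_of_abs_dDeriv_le _ (h0 m (by omega)) _ hB (fun i β => ?_) α).trans_eq (by ring)
    change |dDerivLin i (dDerivMLin m g) β| ≤ _
    rw [dDerivLin_dDerivMLin]
    refine ih _ ?_ β
    have h1 := Finset.sum_update_of_mem (Finset.mem_univ i) m (m i + 1)
    have h2 := Finset.sum_update_of_mem (Finset.mem_univ i) m (m i)
    rw [Function.update_eq_self] at h2
    omega

theorem stmt2 (n : ℕ) (hn : 1 ≤ n) (f : (Fin n → ℕ) → ℝ) (M : ℝ) (hM : 0 ≤ M) (K p : ℕ)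
    (hd : ∀ m : Fin n → ℕ, (∑ i, m i) = K + 1 →
      ∀ α : Fin n → ℕ, |dDerivM m f α| ≤ M * jap (∑ i, (α i : ℝ)) ^ p) :
    ∃ F : MvPolynomial (Fin n) ℝ, F.totalDegree ≤ K ∧
      ∀ α : Fin n → ℕ,
        |f α - MvPolynomial.eval (fun i => (α i : ℝ)) F|
          ≤ M * (n : ℝ) ^ (K + 1) * jap (∑ i, (α i : ℝ)) ^ (p + K + 1) := by
  obtain ⟨F, hdeg, hle, hlt⟩ := exists_discrete_taylor_polynomial f K
  refine ⟨F, hdeg, fun α => ?_⟩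
  set g : (Fin n → ℕ) → ℝ := f - fun α => MvPolynomial.eval (fun i => (α i : ℝ)) F with hg
  have key := abs_dDerivMLin_le g M hM K p
    (fun k hk => by rw [hg, map_sub, Pi.sub_apply, hle k hk, sub_self])
    (fun m hm α => by
      rw [hg, map_sub, hlt m (by omega), sub_zero, dDerivMLin_apply]
      simpa using hd m hm α)
    (K + 1) 0 (by simp) α
  rw [dDerivMLin_zero] at key
  push_cast at key
  set x : ℝ := ∑ i, (α i : ℝ)
  have hx : 0 ≤ x := Finset.sum_nonneg fun i _ => Nat.cast_nonneg _
  have hj := jap_nonneg x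
  have hn' : (1 : ℝ) ≤ (n : ℝ) ^ (K + 1) := one_le_pow₀ (by exact_mod_cast hn)
  calc |f α - MvPolynomial.eval (fun i => (α i : ℝ)) F| ≤ M * jap x ^ p * x ^ (K + 1) := key
    _ ≤ M * jap x ^ p * jap x ^ (K + 1) := by
      gcongr
      exact le_jap x
    _ = M * 1 * jap x ^ (p + K + 1) := by ring
    _ ≤ M * (n : ℝ) ^ (K + 1) * jap x ^ (p + K + 1) := by gcongr
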